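/- Let i, j with |i−j| > 1 and let x be a Kostant partition with e_i(x) ≠ 0 and e_j(x) ≠ 0. Then e_i(e_j(x)) = e_j(e_i(x)) ≠ 0, φ_i(e_j(x)) = φ_i(x), and φ_j(e_i(x)) = φ_j(x) (Stembridge axiom S2 for the modified operators in the orthogonal case). -/

import Mathlib

open scoped BigOperators

namespace KFC

/-- A (candidate) root is a pair of 1-based indices. -/
abbrev Root : Type := ℕ × ℕ

/-- A Kostant partition is encoded as a multiplicity function on pairs. -/
abbrev KPf : Type := Root → ℕ

/-- An entry of a signed word: a sign (`true` = '+', `false` = '−') together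
with the root lying under it. -/
abbrev Entry : Type := Bool × Root

/-- `p` is a positive root of type `A_{n-1}`. -/
def IsPos (n : ℕ) (p : Root) : Prop := 1 ≤ p.1 ∧ p.1 < p.2 ∧ p.2 ≤ n

/-- `α` is a genuine Kostant partition for type `A_{n-1}`: it is supported on
positive roots. -/
def IsKP (n : ℕ) (α : KPf) : Prop := ∀ p, α p ≠ 0 → IsPos n p

/-- Add one copy of the root `r`. -/
def KPadd (α : KPf) (r : Root) : KPf := fun p => if p = r then α p + 1 else α p

/-- Remove one copy of the root `r`. -/
def KPsub (α : KPf) (r : Root) : KPf := fun p => if p = r then α p - 1 else α p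

/-- Replace one copy of `r` by one copy of `r'`. -/
def KPmove (α : KPf) (r r' : Root) : KPf := KPadd (KPsub α r) r'

/-- The signed word `W_i` of `α`: roots `(a,b)` ordered by decreasing `a` and,
for equal `a`, increasing `b`; a '+' under each `(h,i)` and a '−' under each
`(h,i+1)`. -/
def Wword (n i : ℕ) (α : KPf) : List Entry :=
  ((List.range (n+1)).reverse).flatMap (fun h =>
    List.replicate (α (h, i)) ((true, (h, i)) : Entry) ++
    List.replicate (α (h, i+1)) ((false, (h, i+1)) : Entry))

/-- The signed word `W_i*` of `α`: roots `(a,b)` ordered by increasing `b` and,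
for equal `b`, decreasing `a`; a '+' under each `(i+1,j)` and a '−' under each
`(i,j)`. -/
def Wstar (n i : ℕ) (α : KPf) : List Entry :=
  (List.range (n+1)).flatMap (fun j =>
    List.replicate (α (i+1, j)) ((true, (i+1, j)) : Entry) ++
    List.replicate (α (i, j)) ((false, (i, j)) : Entry))

/-- One step of the left-to-right reduction: a new '+' cancels the rightmost
surviving '−' (the surviving word always has the shape `+^a −^b`). -/
def redStep (s : List Entry) (e : Entry) : List Entry :=
  match e.1, s.getLast? with
  | true, some (false, _) => s.dropLast
  | _, _ => s ++ [e]

/-- The reduced word (list of surviving entries, in order). -/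
def reduceW (w : List Entry) : List Entry := w.foldl redStep []

def plusCt (w : List Entry) : ℕ := (w.filter (fun e => e.1)).length
def minusCt (w : List Entry) : ℕ := (w.filter (fun e => !e.1)).length

/-- `a_i`: number of '+' in the reduced word of `W_i`. -/
def aSt (n i : ℕ) (α : KPf) : ℕ := plusCt (reduceW (Wword n i α))
/-- `b_i`: number of '−' in the reduced word of `W_i`. -/
def bSt (n i : ℕ) (α : KPf) : ℕ := minusCt (reduceW (Wword n i α))
/-- `a_i*`. -/
def aStar (n i : ℕ) (α : KPf) : ℕ := plusCt (reduceW (Wstar n i α))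
/-- `b_i*`. -/
def bStar (n i : ℕ) (α : KPf) : ℕ := minusCt (reduceW (Wstar n i α))
/-- `u_i`: number of '+' in the reduced word of `W_i* W_i`. -/
def uSt (n i : ℕ) (α : KPf) : ℕ := plusCt (reduceW (Wstar n i α ++ Wword n i α))
/-- `v_i`: number of '−' in the reduced word of `W_i* W_i`. -/
def vSt (n i : ℕ) (α : KPf) : ℕ := minusCt (reduceW (Wstar n i α ++ Wword n i α))

/-- The root under the rightmost surviving '+'. -/
def lastPlus (w : List Entry) : Option Root :=
  (((reduceW w).filter (fun e => e.1)).getLast?).map Prod.snd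

/-- The root under the leftmost surviving '−'. -/
def headMinus (w : List Entry) : Option Root :=
  (((reduceW w).filter (fun e => !e.1)).head?).map Prod.snd

/-- The operator `f̃_i`. -/
def ftilde (n i : ℕ) (α : KPf) : Option KPf :=
  match lastPlus (Wword n i α) with
  | some r => some (KPmove α r (r.1, i+1))
  | none => some (KPadd α (i, i+1))

/-- The operator `ẽ_i`. -/
def etilde (n i : ℕ) (α : KPf) : Option KPf :=
  match headMinus (Wword n i α) with
  | some r => if r = (i, i+1) then some (KPsub α (i, i+1)) else some (KPmove α r (r.1, i))
  | none => none

/-- The operator `f̃_i*`. -/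
def ftildeS (n i : ℕ) (α : KPf) : Option KPf :=
  match lastPlus (Wstar n i α) with
  | some r => some (KPmove α r (i, r.2))
  | none => some (KPadd α (i, i+1))

/-- The operator `ẽ_i*`. -/
def etildeS (n i : ℕ) (α : KPf) : Option KPf :=
  match headMinus (Wstar n i α) with
  | some r => if r = (i, i+1) then some (KPsub α (i, i+1)) else some (KPmove α r (i+1, r.2))
  | none => none

/-- The modified operator `f_i`. -/
def fop (n i : ℕ) (α : KPf) : Option KPf :=
  if bStar n i α < aSt n i α then ftilde n i α
  else if 0 < aStar n i α then ftildeS n i α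
  else none

/-- The modified operator `e_i`. -/
def eop (n i : ℕ) (α : KPf) : Option KPf :=
  if bStar n i α ≤ aSt n i α then
    (if 0 < bSt n i α ∧ headMinus (Wword n i α) ≠ some (i, i+1) then etilde n i α else none)
  else
    (if headMinus (Wstar n i α) ≠ some (i, i+1) then etildeS n i α else none)

/-- The operator `ê_i`. -/
def ehat (n i : ℕ) (α : KPf) : Option KPf :=
  if bStar n i α ≤ aSt n i α then (if 0 < bSt n i α then etilde n i α else none)
  else etildeS n i α

/-- Iterate a partially defined operator (`none` plays the role of `0`). -/
def iterO (g : KPf → Option KPf) : ℕ → KPf → Option KPf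
  | 0, x => some x
  | k+1, x => (g x).bind (iterO g k)

/-- `ε_i(x) = max {k : e_i^k x ≠ 0}`. -/
noncomputable def epsS (n i : ℕ) (x : KPf) : ℕ := sSup {k | iterO (eop n i) k x ≠ none}
/-- `ε̂_i(x) = max {k : ê_i^k x ≠ 0}`. -/
noncomputable def epsHatS (n i : ℕ) (x : KPf) : ℕ := sSup {k | iterO (ehat n i) k x ≠ none}
/-- `φ_i(x) = max {k : f_i^k x ≠ 0}`. -/
noncomputable def phiS (n i : ℕ) (x : KPf) : ℕ := sSup {k | iterO (fop n i) k x ≠ none}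

noncomputable def epsO (n i : ℕ) (o : Option KPf) : ℕ := o.elim 0 (epsS n i)
noncomputable def epsHatO (n i : ℕ) (o : Option KPf) : ℕ := o.elim 0 (epsHatS n i)
noncomputable def phiO (n i : ℕ) (o : Option KPf) : ℕ := o.elim 0 (phiS n i)

/-- `e_l(γ) ≃ 0`. -/
def simZero (n l : ℕ) (γ : KPf) : Prop := eop n l γ ≠ ehat n l γ

/-- `e_l e_m (γ) ≃ 0`. -/
def simZero2 (n l m : ℕ) (γ : KPf) : Prop := ∃ δ, eop n m γ = some δ ∧ simZero n l δ

/-- The box containing all relevant pairs. -/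
def kbox (n : ℕ) : Finset (ℕ × ℕ) := Finset.range (n+1) ×ˢ Finset.range (n+1)

/-- `|α|`: number of parts of the Kostant partition. -/
def kpSize (n : ℕ) (α : KPf) : ℕ := ∑ p ∈ kbox n, α p

/-- The evaluation `ᾱ ∈ ℤ^n` (as a function on 1-based coordinates). -/
def kpEval (n : ℕ) (α : KPf) : ℕ → ℤ :=
  fun k => ∑ p ∈ kbox n, (α p : ℤ) * ((if p.1 = k then 1 else 0) - (if p.2 = k then 1 else 0))

/-- The simple root `α_i = ε_i − ε_{i+1}` as a vector. -/
def srVec (i : ℕ) : ℕ → ℤ := fun k => (if k = i then 1 else 0) - (if k = i+1 then 1 else 0)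

/-- `ρ = (n-1, n-2, …, 1, 0)` (on 1-based coordinates `1..n`). -/
def rhoVec (n : ℕ) : ℕ → ℤ := fun k => (n : ℤ) - k

/-- `⟨γ, α_i^∨⟩ = γ_i − γ_{i+1}`. -/
def pairCo (γ : ℕ → ℤ) (i : ℕ) : ℤ := γ i - γ (i+1)

/-- The permutation of 1-based coordinates induced by `w : Perm (Fin n)`. -/
def extP (n : ℕ) (w : Equiv.Perm (Fin n)) (k : ℕ) : ℕ :=
  if h : 1 ≤ k ∧ k ≤ n then ((w ⟨k - 1, by omega⟩ : Fin n) : ℕ) + 1 else k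

/-- `S_n` acting on `ℤ^n` by permuting coordinates: `(w·v)_k = v_{w⁻¹(k)}`. -/
def permAct (n : ℕ) (w : Equiv.Perm (Fin n)) (v : ℕ → ℤ) : ℕ → ℤ :=
  fun k => v (extP n w⁻¹ k)

/-- The simple transposition `s_i = (i, i+1)` (1-based). -/
def sT (n i : ℕ) : Equiv.Perm (Fin n) :=
  if h : 1 ≤ i ∧ i < n then Equiv.swap ⟨i - 1, by omega⟩ ⟨i, h.2⟩ else 1

/-- Coxeter length = number of inversions. -/
def lenP (n : ℕ) (w : Equiv.Perm (Fin n)) : ℕ :=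
  (Finset.univ.filter (fun p : Fin n × Fin n => p.1 < p.2 ∧ w p.2 < w p.1)).card

/-- The left weak Bruhat order: `u ≤ w` iff `ℓ(w) = ℓ(w u⁻¹) + ℓ(u)`. -/
def leftWeakLE (n : ℕ) (u w : Equiv.Perm (Fin n)) : Prop :=
  lenP n w = lenP n (w * u⁻¹) + lenP n u

/-- `λ + ρ` as a vector. -/
def lamRho (n : ℕ) (lam : ℕ → ℤ) : ℕ → ℤ := fun k => lam k + rhoVec n k

/-- `(w, α) ∈ S_{λ,μ}`, i.e. `ᾱ = w(λ+ρ) − (μ+ρ)`. -/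
def InS (n : ℕ) (lam mu : ℕ → ℤ) (w : Equiv.Perm (Fin n)) (α : KPf) : Prop :=
  IsKP n α ∧ ∀ k, 1 ≤ k → k ≤ n →
    kpEval n α k = permAct n w (lamRho n lam) k - (mu k + rhoVec n k)

/-- A directed edge `(w,α) →^i (s_i w, β)` of the `Φ`-graph. -/
def PhiEdge (n : ℕ) (lam mu : ℕ → ℤ) (v v' : Equiv.Perm (Fin n) × KPf) : Prop :=
  InS n lam mu v.1 v.2 ∧ InS n lam mu v'.1 v'.2 ∧
  ∃ i, 1 ≤ i ∧ i ≤ n - 1 ∧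
    pairCo (permAct n v.1 (lamRho n lam)) i < 0 ∧
    v'.1 = sT n i * v.1 ∧
    iterO (fop n i) (-(pairCo (permAct n v.1 (lamRho n lam)) i)).toNat v.2 = some v'.2

/-- Being in the same connected component of (the underlying undirected graph of)
the `Φ`-graph. -/
def Conn (n : ℕ) (lam mu : ℕ → ℤ) (v v' : Equiv.Perm (Fin n) × KPf) : Prop :=
  Relation.ReflTransGen (fun a b => PhiEdge n lam mu a b ∨ PhiEdge n lam mu b a) v v'

/-- `(w,β)` has a broken hexagon, broken by `Φ_i` after `Φ_j`. -/
def BrokenHexAt (n : ℕ) (lam mu : ℕ → ℤ) (w : Equiv.Perm (Fin n)) (β : KPf) (i j : ℕ) : Prop :=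
  (j = i + 1 ∨ i = j + 1) ∧ 1 ≤ i ∧ i ≤ n - 1 ∧ 1 ≤ j ∧ j ≤ n - 1 ∧
  0 < pairCo (permAct n w (lamRho n lam)) i ∧
  0 < pairCo (permAct n w (lamRho n lam)) j ∧
  iterO (eop n i) (pairCo (permAct n w (lamRho n lam)) i).toNat β ≠ none ∧
  ∃ δ, iterO (eop n j) (pairCo (permAct n w (lamRho n lam)) j).toNat β = some δ ∧
    epsS n i δ < (pairCo (permAct n w (lamRho n lam)) i).toNat +
      (pairCo (permAct n w (lamRho n lam)) j).toNat

/-- `γ` is obtained from `β` by an initial segment of the operator sequence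
(`e_i` applied `ki` times, then `e_j` applied `ki+kj` times, then `e_i` applied
`kj` times). -/
def alongPath (n i j ki kj : ℕ) (β γ : KPf) : Prop :=
  (∃ a ≤ ki, iterO (eop n i) a β = some γ) ∨
  (∃ b ≤ ki + kj, (iterO (eop n i) ki β).bind (iterO (eop n j) b) = some γ) ∨
  (∃ c ≤ kj, ((iterO (eop n i) ki β).bind (iterO (eop n j) (ki + kj))).bind
      (iterO (eop n i) c) = some γ)

/-- Conjecture A: no broken diamonds along the hexagon paths. -/
def ConjA (n : ℕ) (lam mu : ℕ → ℤ) : Prop :=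
  ∀ (w : Equiv.Perm (Fin n)) (β : KPf) (i j : ℕ),
    InS n lam mu w β → 1 ≤ i → i ≤ n - 1 → 1 ≤ j → j ≤ n - 1 → (j = i + 1 ∨ i = j + 1) →
    ∀ ki kj : ℤ,
      ki = pairCo (permAct n w (lamRho n lam)) i →
      kj = pairCo (permAct n w (lamRho n lam)) j →
      0 < ki → 0 < kj →
      iterO (eop n i) ki.toNat β ≠ none → iterO (eop n j) kj.toNat β ≠ none →
      ∀ γ : KPf,
        (alongPath n i j ki.toNat kj.toNat β γ ∨ alongPath n j i kj.toNat ki.toNat β γ) →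
        ¬ (simZero2 n i j γ ∧ simZero2 n j i γ)

/-- Conjecture B: broken hexagons propagate up to the source vertex. -/
def ConjB (n : ℕ) (lam mu : ℕ → ℤ) : Prop :=
  ∀ (w : Equiv.Perm (Fin n)) (β α : KPf) (i j : ℕ),
    InS n lam mu w β → InS n lam mu 1 α → Conn n lam mu (1, α) (w, β) →
    BrokenHexAt n lam mu w β i j → ∃ j', BrokenHexAt n lam mu 1 α i j'

/-- The Kostka–Foulkes polynomial `K_{λ,μ}(t) = Σ_{(w,α) ∈ S_{λ,μ}} sgn(w) t^{|α|}`. -/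
noncomputable def KF (n : ℕ) (lam mu : ℕ → ℤ) : Polynomial ℤ :=
  ∑ᶠ (w : Equiv.Perm (Fin n)) (α : KPf) (_ : InS n lam mu w α),
    ((Equiv.Perm.sign w : ℤ) • (Polynomial.X ^ kpSize n α) : Polynomial ℤ)

end KFC

namespace KFC

theorem redStep_minus (s : List Entry) {e : Entry} (he : e.1 = false) :
    redStep s e = s ++ [e] := by
  simp [redStep, he]

theorem redStep_plus_snoc_minus (s : List Entry) {m e : Entry} (hm : m.1 = false)
    (he : e.1 = true) : redStep (s ++ [m]) e = s := by
  obtain ⟨m1, m2⟩ := m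
  simp only at hm
  simp [redStep, he, hm]

theorem redStep_of_forall_plus {s : List Entry} (hs : ∀ e ∈ s, e.1 = true) (e : Entry) :
    redStep s e = s ++ [e] := by
  unfold redStep
  split
  · rename_i hl
    have := hs _ (List.mem_of_getLast? hl)
    simp at this
  · rfl

theorem reduceW_append_singleton (v : List Entry) (e : Entry) :
    reduceW (v ++ [e]) = redStep (reduceW v) e := by
  simp [reduceW]

/-- Reducing `v` on top of an already reduced word `P ++ M`. -/
theorem foldl_redStep {P M : List Entry} (hP : ∀ e ∈ P, e.1 = true) (hM : ∀ e ∈ M, e.1 = false)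
    (v : List Entry) :
    ∃ P' M' : List Entry, (∀ e ∈ P', e.1 = true ∧ e ∈ v) ∧ (∀ e ∈ M', e.1 = false ∧ e ∈ v) ∧
      reduceW v = P' ++ M' ∧
      v.foldl redStep (P ++ M) =
        (P ++ P'.drop M.length) ++ (M.take (M.length - P'.length) ++ M') := by
  induction v using List.reverseRecOn with
  | nil => exact ⟨[], [], by simp, by simp, rfl, by simp⟩
  | append_singleton v e ih =>
    obtain ⟨P', M', hP', hM', hr, hf⟩ := ih
    have hr' : reduceW (v ++ [e]) = redStep (P' ++ M') e := by
      rw [reduceW_append_singleton, hr]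
    rw [hr', List.foldl_append, hf]
    simp only [List.foldl_cons, List.foldl_nil]
    cases he : e.1 with
    | false =>
      refine ⟨P', M' ++ [e], fun a ha => ?_, fun a ha => ?_, ?_, ?_⟩
      · have := hP' a ha; simp [this]
      · rcases List.mem_append.1 ha with h | h
        · have := hM' a h; simp [this]
        · simp_all
      · simp [redStep_minus _ he]
      · simp [redStep_minus _ he]
    | true =>
      rcases List.eq_nil_or_concat M' with rfl | ⟨M₀, m, hM₀⟩
      · refine ⟨P' ++ [e], [], fun a ha => ?_, by simp, ?_, ?_⟩
        · rcases List.mem_append.1 ha with h | h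
          · have := hP' a h; simp [this]
          · simp_all
        · simp [redStep_of_forall_plus (fun a ha => (hP' a ha).1)]
        · by_cases hlt : P'.length < M.length
          · obtain ⟨k, hk⟩ : ∃ k, M.length - P'.length = k + 1 := ⟨M.length - P'.length - 1, by omega⟩
            have hk' : k < M.length := by omega
            have h1 : P'.drop M.length = [] := List.drop_eq_nil_of_le (by omega)
            have h2 : (P' ++ [e]).drop M.length = [] :=
              List.drop_eq_nil_of_le (by simp; omega)
            have h3 : M.length - (P' ++ [e]).length = k := by simp; omega
            rw [h1, h2, h3, hk, List.take_succ_eq_append_getElem hk']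
            simp only [List.append_nil, ← List.append_assoc]
            exact redStep_plus_snoc_minus _ (hM _ (List.getElem_mem hk')) he
          · have h1 : M.length - P'.length = 0 := by omega
            have h2 : M.length - (P' ++ [e]).length = 0 := by simp; omega
            rw [h1, h2, List.drop_append_of_le_length (by omega)]
            simp only [List.take_zero, List.append_nil]
            rw [redStep_of_forall_plus, List.append_assoc]
            intro a ha
            rcases List.mem_append.1 ha with h | h
            · exact hP a h
            · exact (hP' a (List.mem_of_mem_drop h)).1
      · rw [List.concat_eq_append] at hM₀
        subst hM₀
        have hm : m.1 = false := (hM' m (by simp)).1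
        refine ⟨P', M₀, fun a ha => ?_, fun a ha => ?_, ?_, ?_⟩
        · have := hP' a ha; simp [this]
        · have := hM' a (by simp [ha]); simp [this]
        · rw [← List.append_assoc]; exact redStep_plus_snoc_minus _ hm he
        · simp only [← List.append_assoc]; exact redStep_plus_snoc_minus _ hm he

/-- The reduced word has the shape `+^a −^b`. -/
theorem exists_reduceW (v : List Entry) :
    ∃ P M : List Entry, (∀ e ∈ P, e.1 = true ∧ e ∈ v) ∧ (∀ e ∈ M, e.1 = false ∧ e ∈ v) ∧
      reduceW v = P ++ M := by
  obtain ⟨P, M, h1, h2, h3, -⟩ := foldl_redStep (P := []) (M := []) (by simp) (by simp) v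
  exact ⟨P, M, h1, h2, h3⟩

theorem filter_plus {P M : List Entry} (hP : ∀ e ∈ P, e.1 = true) (hM : ∀ e ∈ M, e.1 = false) :
    (P ++ M).filter (fun e => e.1) = P := by
  rw [List.filter_append, List.filter_eq_self.2 (by simpa using hP),
    List.filter_eq_nil_iff.2 (by simpa using hM), List.append_nil]

theorem filter_minus {P M : List Entry} (hP : ∀ e ∈ P, e.1 = true) (hM : ∀ e ∈ M, e.1 = false) :
    (P ++ M).filter (fun e => !e.1) = M := by
  rw [List.filter_append, List.filter_eq_nil_iff.2 (by simpa using hP),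
    List.filter_eq_self.2 (by simpa using hM), List.nil_append]

/-- Number of surviving '+'. -/
abbrev rplus (w : List Entry) : ℕ := plusCt (reduceW w)
/-- Number of surviving '−'. -/
abbrev rminus (w : List Entry) : ℕ := minusCt (reduceW w)

theorem reduced_append (u v : List Entry) :
    rplus (u ++ v) = rplus u + (rplus v - rminus u) ∧
    rminus (u ++ v) = (rminus u - rplus v) + rminus v ∧
    headMinus (u ++ v) = (if rplus v < rminus u then headMinus u else headMinus v) ∧
    lastPlus (u ++ v) = (if rminus u < rplus v then lastPlus v else lastPlus u) := by
  obtain ⟨P, M, hP, hM, hu⟩ := exists_reduceW u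
  obtain ⟨P', M', hP', hM', hv, hf⟩ :=
    foldl_redStep (fun e he => (hP e he).1) (fun e he => (hM e he).1) v
  have huv : reduceW (u ++ v) =
      (P ++ P'.drop M.length) ++ (M.take (M.length - P'.length) ++ M') := by
    rw [← hf, ← hu]; simp [reduceW]
  have q1 : ∀ e ∈ P ++ P'.drop M.length, e.1 = true := by
    intro a ha
    rcases List.mem_append.1 ha with h | h
    · exact (hP a h).1
    · exact (hP' a (List.mem_of_mem_drop h)).1
  have q2 : ∀ e ∈ M.take (M.length - P'.length) ++ M', e.1 = false := by
    intro a ha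
    rcases List.mem_append.1 ha with h | h
    · exact (hM a (List.mem_of_mem_take h)).1
    · exact (hM' a h).1
  have f1 := filter_plus (fun e he => (hP e he).1) (fun e he => (hM e he).1)
  have f2 := filter_minus (fun e he => (hP e he).1) (fun e he => (hM e he).1)
  have f3 := filter_plus (fun e he => (hP' e he).1) (fun e he => (hM' e he).1)
  have f4 := filter_minus (fun e he => (hP' e he).1) (fun e he => (hM' e he).1)
  simp only [rplus, rminus, plusCt, minusCt, headMinus, lastPlus, huv, hu, hv,
    filter_plus q1 q2, filter_minus q1 q2, f1, f2, f3, f4]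
  refine ⟨by simp, by simp, ?_, ?_⟩
  · split_ifs with h
    · rw [List.head?_append, List.head?_take, if_neg (by omega)]
      have : M.head?.isSome := by
        rw [List.isSome_head?]
        exact List.ne_nil_of_length_pos (by omega)
      obtain ⟨m, hm⟩ := Option.isSome_iff_exists.1 this
      simp [hm]
    · rw [Nat.sub_eq_zero_of_le (by omega)]; simp
  · split_ifs with h
    · rw [List.getLast?_append, List.getLast?_drop, if_neg (by omega)]
      have : P'.getLast?.isSome := by
        rw [List.getLast?_isSome]
        exact List.ne_nil_of_length_pos (by omega)
      obtain ⟨m, hm⟩ := Option.isSome_iff_exists.1 this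
      simp [hm]
    · rw [List.drop_eq_nil_of_le (by omega)]; simp

theorem mem_of_headMinus {w : List Entry} {r : Root} (h : headMinus w = some r) :
    (false, r) ∈ w ∧ 0 < rminus w := by
  obtain ⟨P, M, hP, hM, hu⟩ := exists_reduceW w
  have f2 := filter_minus (fun e he => (hP e he).1) (fun e he => (hM e he).1)
  simp only [headMinus, rminus, minusCt, hu, f2, Option.map_eq_some_iff] at h ⊢
  obtain ⟨⟨b, r'⟩, ha, rfl⟩ := h
  have hm := List.mem_of_mem_head? ha
  have := hM _ hm
  simp only at this
  refine ⟨?_, List.length_pos_of_mem hm⟩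
  rw [← this.1]; exact this.2

theorem exists_headMinus {w : List Entry} (h : 0 < rminus w) : ∃ r, headMinus w = some r := by
  obtain ⟨m, hm⟩ := Option.isSome_iff_exists.1
    (List.isSome_head?.2 (List.ne_nil_of_length_pos h))
  exact ⟨m.2, by simp [headMinus, hm]⟩

theorem mem_of_lastPlus {w : List Entry} {r : Root} (h : lastPlus w = some r) :
    (true, r) ∈ w := by
  obtain ⟨P, M, hP, hM, hu⟩ := exists_reduceW w
  have f2 := filter_plus (fun e he => (hP e he).1) (fun e he => (hM e he).1)
  simp only [lastPlus, hu, f2, Option.map_eq_some_iff] at h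
  obtain ⟨⟨b, r'⟩, ha, rfl⟩ := h
  have := hP _ (List.mem_of_mem_getLast? ha)
  simp only at this
  rw [← this.1]; exact this.2

theorem exists_lastPlus {w : List Entry} (h : 0 < rplus w) : ∃ r, lastPlus w = some r := by
  obtain ⟨m, hm⟩ := Option.isSome_iff_exists.1
    (List.getLast?_isSome.2 (List.ne_nil_of_length_pos h))
  exact ⟨m.2, by simp [lastPlus, hm]⟩

/-- A block `+^p −^m`. -/
abbrev blk (p m : ℕ) (r r' : Root) : List Entry :=
  List.replicate p ((true, r) : Entry) ++ List.replicate m ((false, r') : Entry)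

theorem reduceW_blk (p m : ℕ) (r r' : Root) : reduceW (blk p m r r') = blk p m r r' := by
  induction m with
  | zero =>
    induction p with
    | zero => rfl
    | succ p ih =>
      simp only [blk, List.replicate_zero, List.append_nil] at ih ⊢
      rw [List.replicate_succ', reduceW_append_singleton, ih, redStep_of_forall_plus]
      simp
  | succ m ih =>
    rw [blk, List.replicate_succ', ← List.append_assoc, reduceW_append_singleton, ih,
      redStep_minus _ rfl]

theorem reduced_blk (p m : ℕ) (r r' : Root) :
    rplus (blk p m r r') = p ∧ rminus (blk p m r r') = m ∧
    headMinus (blk p m r r') = (if 0 < m then some r' else none) ∧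
    lastPlus (blk p m r r') = (if 0 < p then some r else none) := by
  have f1 := filter_plus (P := List.replicate p ((true, r) : Entry))
    (M := List.replicate m ((false, r') : Entry)) (by simp) (by simp)
  have f2 := filter_minus (P := List.replicate p ((true, r) : Entry))
    (M := List.replicate m ((false, r') : Entry)) (by simp) (by simp)
  simp only [rplus, rminus, plusCt, minusCt, headMinus, lastPlus, reduceW_blk, blk, f1, f2]
  refine ⟨by simp, by simp, ?_, ?_⟩
  · rcases m with _ | m <;> simp [List.replicate_succ]
  · rcases p with _ | p <;> simp [List.replicate_succ']

/-- The word whose consecutive blocks, indexed by `L`, carry '+' under `pl h` and '−' under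
`mi h`. -/
def genWord (L : List ℕ) (pl mi : ℕ → Root) (x : KPf) : List Entry :=
  L.flatMap fun h => blk (x (pl h)) (x (mi h)) (pl h) (mi h)

theorem genWord_append (L L' : List ℕ) (pl mi : ℕ → Root) (x : KPf) :
    genWord (L ++ L') pl mi x = genWord L pl mi x ++ genWord L' pl mi x := by
  simp [genWord]

theorem genWord_singleton (h : ℕ) (pl mi : ℕ → Root) (x : KPf) :
    genWord [h] pl mi x = blk (x (pl h)) (x (mi h)) (pl h) (mi h) := by
  simp [genWord]

theorem genWord_congr {L : List ℕ} {pl mi : ℕ → Root} {x y : KPf}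
    (hxy : ∀ h ∈ L, x (pl h) = y (pl h) ∧ x (mi h) = y (mi h)) :
    genWord L pl mi x = genWord L pl mi y := by
  simp only [genWord, List.flatMap]
  congr 1
  apply List.map_congr_left
  intro h hh
  rw [(hxy h hh).1, (hxy h hh).2]

theorem mem_genWord_plus {L : List ℕ} {pl mi : ℕ → Root} {x : KPf} {r : Root}
    (h : (true, r) ∈ genWord L pl mi x) : ∃ k ∈ L, r = pl k ∧ x r ≠ 0 := by
  simp only [genWord, List.mem_flatMap, List.mem_append, List.mem_replicate] at h
  grind

theorem mem_genWord_minus {L : List ℕ} {pl mi : ℕ → Root} {x : KPf} {r : Root}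
    (h : (false, r) ∈ genWord L pl mi x) : ∃ k ∈ L, r = mi k ∧ x r ≠ 0 := by
  simp only [genWord, List.mem_flatMap, List.mem_append, List.mem_replicate] at h
  grind

/-- Turning the rightmost surviving '+' into a '−' changes the counts by one. -/
theorem genWord_lastPlus_move {L : List ℕ} {pl mi : ℕ → Root} {x y : KPf} {k : ℕ}
    (hL : L.Nodup) (hpl : Function.Injective pl)
    (hlast : lastPlus (genWord L pl mi x) = some (pl k))
    (hxy : ∀ h, h ≠ k → x (pl h) = y (pl h) ∧ x (mi h) = y (mi h))
    (hp : x (pl k) = y (pl k) + 1) (hm : y (mi k) = x (mi k) + 1) :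
    rplus (genWord L pl mi x) = rplus (genWord L pl mi y) + 1 ∧
    rminus (genWord L pl mi y) = rminus (genWord L pl mi x) + 1 := by
  obtain ⟨k', hk, he, -⟩ := mem_genWord_plus (mem_of_lastPlus hlast)
  obtain rfl := hpl he
  obtain ⟨U, V, rfl⟩ := List.append_of_mem hk
  have hUV : k ∉ U ∧ k ∉ V := by
    rw [List.nodup_append, List.nodup_cons] at hL
    exact ⟨fun h => hL.2.2 k h k (by simp) rfl, hL.2.1.1⟩
  have e : U ++ k :: V = (U ++ [k]) ++ V := by simp
  rw [e] at hlast ⊢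
  simp only [genWord_append, genWord_singleton] at hlast ⊢
  have hU : genWord U pl mi y = genWord U pl mi x :=
    genWord_congr fun h hh => by have := hxy h (by grind); simp [this]
  have hV : genWord V pl mi y = genWord V pl mi x :=
    genWord_congr fun h hh => by have := hxy h (by grind); simp [this]
  rw [hU, hV]
  have nU : lastPlus (genWord U pl mi x) ≠ some (pl k) := fun h => by
    obtain ⟨k', hk', he, -⟩ := mem_genWord_plus (mem_of_lastPlus h)
    exact hUV.1 (hpl he ▸ hk')
  have nV : lastPlus (genWord V pl mi x) ≠ some (pl k) := fun h => by
    obtain ⟨k', hk', he, -⟩ := mem_genWord_plus (mem_of_lastPlus h)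
    exact hUV.2 (hpl he ▸ hk')
  have b1 := reduced_blk (x (pl k)) (x (mi k)) (pl k) (mi k)
  have b2 := reduced_blk (y (pl k)) (y (mi k)) (pl k) (mi k)
  generalize blk (x (pl k)) (x (mi k)) (pl k) (mi k) = B at *
  generalize blk (y (pl k)) (y (mi k)) (pl k) (mi k) = B' at *
  generalize genWord U pl mi x = u at *
  generalize genWord V pl mi x = v at *
  have r1 := reduced_append (u ++ B) v
  have r2 := reduced_append u B
  have r3 := reduced_append (u ++ B') v
  have r4 := reduced_append u B'
  rw [r1.2.2.2] at hlast
  split_ifs at hlast with c1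
  · exact absurd hlast nV
  · rw [r2.2.2.2] at hlast
    split_ifs at hlast with c2
    · omega
    · exact absurd hlast nU

/-- The leftmost surviving '−' of two consecutive blocks. -/
def pairHead (s t : ℕ) (pl mi : ℕ → Root) (x : KPf) : Option Root :=
  if x (pl t) < x (mi s) then some (mi s) else if 0 < x (mi t) then some (mi t) else none

theorem reduced_pair (s t : ℕ) (pl mi : ℕ → Root) (x : KPf) :
    rplus (genWord [s, t] pl mi x) = x (pl s) + (x (pl t) - x (mi s)) ∧
    rminus (genWord [s, t] pl mi x) = (x (mi s) - x (pl t)) + x (mi t) ∧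
    headMinus (genWord [s, t] pl mi x) = pairHead s t pl mi x := by
  have e : [s, t] = [s] ++ [t] := rfl
  rw [e, genWord_append, genWord_singleton, genWord_singleton]
  have b1 := reduced_blk (x (pl s)) (x (mi s)) (pl s) (mi s)
  have b2 := reduced_blk (x (pl t)) (x (mi t)) (pl t) (mi t)
  have r := reduced_append (blk (x (pl s)) (x (mi s)) (pl s) (mi s))
    (blk (x (pl t)) (x (mi t)) (pl t) (mi t))
  refine ⟨by omega, by omega, ?_⟩
  rw [r.2.2.1, b1.2.1, b2.1, b1.2.2.1, b2.2.2.1, pairHead]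
  split_ifs <;> first | rfl | omega

/-- Modifying two consecutive blocks without changing their reduced counts. -/
theorem genWord_pair_change {U V : List ℕ} {s t : ℕ} {pl mi : ℕ → Root} {x y : KPf}
    (hxy : ∀ h, h ≠ s → h ≠ t → x (pl h) = y (pl h) ∧ x (mi h) = y (mi h))
    (hU : s ∉ U ∧ t ∉ U) (hV : s ∉ V ∧ t ∉ V)
    (hp : x (pl s) + (x (pl t) - x (mi s)) = y (pl s) + (y (pl t) - y (mi s)))
    (hm : (x (mi s) - x (pl t)) + x (mi t) = (y (mi s) - y (pl t)) + y (mi t)) :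
    rplus (genWord (U ++ [s, t] ++ V) pl mi y) = rplus (genWord (U ++ [s, t] ++ V) pl mi x) ∧
    rminus (genWord (U ++ [s, t] ++ V) pl mi y) = rminus (genWord (U ++ [s, t] ++ V) pl mi x) ∧
    (headMinus (genWord (U ++ [s, t] ++ V) pl mi y) =
        headMinus (genWord (U ++ [s, t] ++ V) pl mi x) ∧
        (∀ r, headMinus (genWord (U ++ [s, t] ++ V) pl mi x) = some r →
          ∃ k, k ≠ s ∧ k ≠ t ∧ r = mi k) ∨
      headMinus (genWord (U ++ [s, t] ++ V) pl mi x) = pairHead s t pl mi x ∧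
      headMinus (genWord (U ++ [s, t] ++ V) pl mi y) = pairHead s t pl mi y) := by
  have hU' : genWord U pl mi y = genWord U pl mi x :=
    genWord_congr fun h hh => by have := hxy h (by grind) (by grind); simp [this]
  have hV' : genWord V pl mi y = genWord V pl mi x :=
    genWord_congr fun h hh => by have := hxy h (by grind) (by grind); simp [this]
  simp only [genWord_append, hU', hV']
  have nU : ∀ r, headMinus (genWord U pl mi x) = some r → ∃ k, k ≠ s ∧ k ≠ t ∧ r = mi k := by
    intro r h
    obtain ⟨k, hk, e, -⟩ := mem_genWord_minus (mem_of_headMinus h).1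
    exact ⟨k, by grind, by grind, e⟩
  have nV : ∀ r, headMinus (genWord V pl mi x) = some r → ∃ k, k ≠ s ∧ k ≠ t ∧ r = mi k := by
    intro r h
    obtain ⟨k, hk, e, -⟩ := mem_genWord_minus (mem_of_headMinus h).1
    exact ⟨k, by grind, by grind, e⟩
  have b1 := reduced_pair s t pl mi x
  have b2 := reduced_pair s t pl mi y
  rw [← b1.2.2, ← b2.2.2]
  generalize genWord [s, t] pl mi x = B at *
  generalize genWord [s, t] pl mi y = B' at *
  generalize genWord U pl mi x = u at *
  generalize genWord V pl mi x = v at *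
  have r1 := reduced_append (u ++ B) v
  have r2 := reduced_append u B
  have r3 := reduced_append (u ++ B') v
  have r4 := reduced_append u B'
  refine ⟨by omega, by omega, ?_⟩
  rw [r1.2.2.1, r2.2.2.1, r3.2.2.1, r4.2.2.1]
  have q1 : rplus B' = rplus B := by omega
  have q2 : rminus (u ++ B') = rminus (u ++ B) := by omega
  rw [q1, q2]
  split_ifs
  · exact Or.inl ⟨rfl, nU⟩
  · exact Or.inr ⟨rfl, rfl⟩
  · exact Or.inl ⟨rfl, nV⟩

theorem Wword_eq_genWord (n i : ℕ) (x : KPf) :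
    Wword n i x = genWord (List.range (n + 1)).reverse (fun h => (h, i)) (fun h => (h, i + 1)) x :=
  rfl

theorem Wstar_eq_genWord (n i : ℕ) (x : KPf) :
    Wstar n i x = genWord (List.range (n + 1)) (fun k => (i + 1, k)) (fun k => (i, k)) x :=
  rfl

theorem range_split {n j : ℕ} (hj : j + 1 ≤ n) :
    ∃ U V : List ℕ, List.range (n + 1) = U ++ [j, j + 1] ++ V ∧
      (j ∉ U ∧ j + 1 ∉ U) ∧ (j ∉ V ∧ j + 1 ∉ V) := by
  refine ⟨List.range' 0 j, List.range' (j + 2) (n - 1 - j), ?_, ?_, ?_⟩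
  · have e : [j, j + 1] = List.range' j 2 := rfl
    have h1 : List.range' 0 j ++ List.range' j 2 = List.range' 0 (j + 2) := by
      simpa using List.range'_append (s := 0) (m := j) (n := 2) (step := 1)
    have h2 : List.range' 0 (j + 2) ++ List.range' (j + 2) (n - 1 - j) =
        List.range' 0 (j + 2 + (n - 1 - j)) := by
      simpa using List.range'_append (s := 0) (m := j + 2) (n := n - 1 - j) (step := 1)
    rw [e, h1, h2, List.range_eq_range']
    congr 1
    omega
  · simp [List.mem_range']
  · simp only [List.mem_range']
    omega

theorem KPmove_apply (x : KPf) {r r' : Root} (hne : r ≠ r') (p : Root) :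
    KPmove x r r' p = if p = r then x p - 1 else if p = r' then x p + 1 else x p := by
  simp only [KPmove, KPadd, KPsub]
  split_ifs <;> simp_all

theorem KPmove_apply_of_ne (x : KPf) {r r' p : Root} (h : p ≠ r) (h' : p ≠ r') :
    KPmove x r r' p = x p := by
  simp [KPmove, KPadd, KPsub, h, h']

theorem KPmove_comm (x : KPf) {r r' s s' : Root} (h1 : r ≠ s) (h2 : r ≠ s') (h3 : r' ≠ s)
    (h4 : r' ≠ s') : KPmove (KPmove x r r') s s' = KPmove (KPmove x s s') r r' := by
  funext p
  simp only [KPmove, KPadd, KPsub]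
  grind

theorem IsKP.move {n : ℕ} {x : KPf} (hx : IsKP n x) (r : Root) {r' : Root} (hr' : IsPos n r') :
    IsKP n (KPmove x r r') := by
  intro p hp
  by_cases h : p = r'
  · exact h ▸ hr'
  · refine hx p fun h0 => hp ?_
    simp [KPmove, KPadd, KPsub, h, h0]

theorem Wword_move {n i : ℕ} (x : KPf) {r r' : Root} (h1 : r.2 ≠ i) (h2 : r.2 ≠ i + 1)
    (h3 : r'.2 ≠ i) (h4 : r'.2 ≠ i + 1) : Wword n i (KPmove x r r') = Wword n i x := by
  simp only [Wword_eq_genWord]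
  refine genWord_congr fun h _ => ⟨?_, ?_⟩ <;> refine KPmove_apply_of_ne _ ?_ ?_ <;> grind

theorem Wstar_move {n i : ℕ} (x : KPf) {r r' : Root} (h1 : r.1 ≠ i) (h2 : r.1 ≠ i + 1)
    (h3 : r'.1 ≠ i) (h4 : r'.1 ≠ i + 1) : Wstar n i (KPmove x r r') = Wstar n i x := by
  simp only [Wstar_eq_genWord]
  refine genWord_congr fun h _ => ⟨?_, ?_⟩ <;> refine KPmove_apply_of_ne _ ?_ ?_ <;> grind

theorem headMinus_Wword {n i : ℕ} {x : KPf} {r : Root} (h : headMinus (Wword n i x) = some r) :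
    r = (r.1, i + 1) ∧ x r ≠ 0 ∧ 0 < bSt n i x := by
  have m := mem_of_headMinus h
  obtain ⟨k, -, e, hk⟩ := mem_genWord_minus (Wword_eq_genWord n i x ▸ m.1)
  exact ⟨by rw [e], hk, m.2⟩

theorem headMinus_Wstar {n i : ℕ} {x : KPf} {r : Root} (h : headMinus (Wstar n i x) = some r) :
    r = (i, r.2) ∧ x r ≠ 0 := by
  have m := mem_of_headMinus h
  obtain ⟨k, -, e, hk⟩ := mem_genWord_minus (Wstar_eq_genWord n i x ▸ m.1)
  exact ⟨by rw [e], hk⟩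

theorem eop_of_Wword {n i h : ℕ} {x : KPf} (hab : bStar n i x ≤ aSt n i x)
    (hh : headMinus (Wword n i x) = some (h, i + 1)) (hne : h ≠ i) :
    eop n i x = some (KPmove x (h, i + 1) (h, i)) := by
  have := (headMinus_Wword hh).2.2
  simp [eop, etilde, hab, hh, hne, this]

theorem eop_of_Wstar {n i k : ℕ} {x : KPf} (hab : aSt n i x < bStar n i x)
    (hh : headMinus (Wstar n i x) = some (i, k)) (hne : k ≠ i + 1) :
    eop n i x = some (KPmove x (i, k) (i + 1, k)) := by
  simp [eop, etildeS, not_le.2 hab, hh, hne]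

theorem eop_cases {n i : ℕ} {x : KPf} (hx : IsKP n x) (he : eop n i x ≠ none) :
    (bStar n i x ≤ aSt n i x ∧ ∃ h, 1 ≤ h ∧ h < i ∧ x (h, i + 1) ≠ 0 ∧
      headMinus (Wword n i x) = some (h, i + 1)) ∨
    (aSt n i x < bStar n i x ∧ ∃ k, i + 1 < k ∧ k ≤ n ∧ x (i, k) ≠ 0 ∧
      headMinus (Wstar n i x) = some (i, k)) := by
  by_cases hab : bStar n i x ≤ aSt n i x
  · left
    simp only [eop, if_pos hab] at he
    split_ifs at he with hc
    · obtain ⟨r, hr⟩ := exists_headMinus hc.1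
      have h2 := headMinus_Wword hr
      have h3 := hx r h2.2.1
      rw [h2.1] at hr h3 h2
      have h4 := hc.2
      rw [hr] at h4
      simp only [IsPos] at h3
      have : r.1 ≠ i := fun h => h4 (by rw [h])
      exact ⟨hab, r.1, h3.1, by omega, h2.2.1, hr⟩
    · exact absurd rfl he
  · right
    have hab' := not_le.1 hab
    simp only [eop, if_neg hab] at he
    split_ifs at he with hc
    · obtain ⟨r, hr⟩ := exists_headMinus (w := Wstar n i x) (Nat.zero_lt_of_lt hab')
      have h2 := headMinus_Wstar hr
      have h3 := hx r h2.2
      rw [h2.1] at hr h3 h2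
      rw [hr] at hc
      simp only [IsPos] at h3
      have : r.2 ≠ i + 1 := fun h => hc (by rw [h])
      exact ⟨hab', r.2, by omega, h3.2.2, h2.2, hr⟩
    · exact absurd rfl he

/-- The closed formula for `φ_i`. -/
def phiVal (n i : ℕ) (x : KPf) : ℕ := (aSt n i x - bStar n i x) + aStar n i x

theorem fop_eq_none {n i : ℕ} {x : KPf} (h : fop n i x = none) : phiVal n i x = 0 := by
  unfold fop ftilde ftildeS at h
  unfold phiVal
  split_ifs at h
  · split at h <;> simp at h
  · split at h <;> simp at h
  · omega

theorem fop_eq_some {n i : ℕ} {x y : KPf} (hi : 1 ≤ i) (hin : i + 1 ≤ n) (hx : IsKP n x)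
    (h : fop n i x = some y) : IsKP n y ∧ phiVal n i x = phiVal n i y + 1 := by
  unfold fop at h
  split_ifs at h with h1 h2
  · obtain ⟨r, hr⟩ := exists_lastPlus (w := Wword n i x) (Nat.zero_lt_of_lt h1)
    simp only [ftilde, hr, Option.some.injEq] at h
    obtain ⟨k, -, rfl, hk⟩ := mem_genWord_plus (Wword_eq_genWord n i x ▸ mem_of_lastPlus hr)
    have hpos := hx _ hk
    simp only [IsPos] at hpos hk h
    subst h
    have hs : Wstar n i (KPmove x (k, i) (k, i + 1)) = Wstar n i x :=
      Wstar_move x (by simp; omega) (by simp; omega) (by simp; omega) (by simp; omega)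
    have hw := genWord_lastPlus_move (y := KPmove x (k, i) (k, i + 1))
      (L := (List.range (n + 1)).reverse) (by simp [List.nodup_range])
      (fun a b hab => by simpa using hab) hr
      (fun h hh => by simp [KPmove_apply, hh])
      (by simp [KPmove_apply]; omega) (by simp [KPmove_apply])
    simp only [← Wword_eq_genWord] at hw
    refine ⟨hx.move _ ⟨hpos.1, by simp; omega, hin⟩, ?_⟩
    simp only [phiVal, aSt, bStar, aStar, hs] at h1 ⊢
    simp only [rplus] at hw
    omega
  · obtain ⟨r, hr⟩ := exists_lastPlus (w := Wstar n i x) h2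
    simp only [ftildeS, hr, Option.some.injEq] at h
    obtain ⟨k, -, rfl, hk⟩ := mem_genWord_plus (Wstar_eq_genWord n i x ▸ mem_of_lastPlus hr)
    have hpos := hx _ hk
    simp only [IsPos] at hpos hk h
    subst h
    have hs : Wword n i (KPmove x (i + 1, k) (i, k)) = Wword n i x :=
      Wword_move x (by simp; omega) (by simp; omega) (by simp; omega) (by simp; omega)
    have hw := genWord_lastPlus_move (y := KPmove x (i + 1, k) (i, k))
      (L := List.range (n + 1)) List.nodup_range
      (fun a b hab => by simpa using hab) hr
      (fun h hh => by simp [KPmove_apply, hh])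
      (by simp [KPmove_apply]; omega) (by simp [KPmove_apply])
    simp only [← Wstar_eq_genWord] at hw
    refine ⟨hx.move _ ⟨hi, by simp; omega, hpos.2.2⟩, ?_⟩
    simp only [phiVal, aSt, bStar, aStar, hs] at h1 ⊢
    simp only [rplus, rminus] at hw
    omega

theorem iterO_fop_ne_none {n i : ℕ} (hi : 1 ≤ i) (hin : i + 1 ≤ n) (k : ℕ) {x : KPf}
    (hx : IsKP n x) : iterO (fop n i) k x ≠ none ↔ k ≤ phiVal n i x := by
  induction k generalizing x with
  | zero => simp [iterO]
  | succ k ih =>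
    cases h : fop n i x with
    | none => simp [iterO, h, fop_eq_none h]
    | some y =>
      obtain ⟨hy, he⟩ := fop_eq_some hi hin hx h
      simp only [iterO, h, Option.bind_some]
      rw [ih hy, he]
      omega

theorem phiS_eq_phiVal {n i : ℕ} (hi : 1 ≤ i) (hin : i + 1 ≤ n) {x : KPf} (hx : IsKP n x) :
    phiS n i x = phiVal n i x := by
  have : {k | iterO (fop n i) k x ≠ none} = Set.Iic (phiVal n i x) := by
    ext k
    exact iterO_fop_ne_none hi hin k hx
  rw [phiS, this, csSup_Iic]

theorem phiS_congr {n i : ℕ} (hi : 1 ≤ i) (hin : i + 1 ≤ n) {x y : KPf} (hx : IsKP n x)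
    (hy : IsKP n y) (h1 : aSt n i y = aSt n i x) (h2 : bStar n i y = bStar n i x)
    (h3 : aStar n i y = aStar n i x) : phiS n i y = phiS n i x := by
  rw [phiS_eq_phiVal hi hin hx, phiS_eq_phiVal hi hin hy, phiVal, phiVal, h1, h2, h3]

/-- If the leftmost surviving '−' of `W_i*` lies in column `j` or `j+1`, it is determined by
these two columns alone. -/
theorem star_block {n i j k : ℕ} {x : KPf} (hj : j + 1 ≤ n)
    (h : headMinus (Wstar n i x) = some (i, k)) (hk : k = j ∨ k = j + 1) :
    headMinus (Wstar n i x) = pairHead j (j + 1) (fun k => (i + 1, k)) (fun k => (i, k)) x := by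
  obtain ⟨U, V, hL, hU, hV⟩ := range_split hj
  rw [Wstar_eq_genWord, hL] at h ⊢
  rcases (genWord_pair_change (x := x) (y := x) (pl := fun k => (i + 1, k))
    (mi := fun k => (i, k)) (by simp) hU hV rfl rfl).2.2 with h1 | h1
  · obtain ⟨k', h2, h3, h4⟩ := h1.2 _ h
    simp only [Prod.mk.injEq] at h4
    omega
  · exact h1.1

theorem reverse_range_split {n i : ℕ} (hi : i + 1 ≤ n) :
    ∃ U V : List ℕ, (List.range (n + 1)).reverse = U ++ [i + 1, i] ++ V ∧
      (i + 1 ∉ U ∧ i ∉ U) ∧ (i + 1 ∉ V ∧ i ∉ V) := by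
  obtain ⟨U, V, hL, hU, hV⟩ := range_split hi
  exact ⟨V.reverse, U.reverse, by simp [hL], by simpa using hV.symm, by simpa using hU.symm⟩

/-- If the leftmost surviving '−' of `W_j` lies in row `i` or `i+1`, it is determined by these
two rows alone. -/
theorem word_block {n i j h : ℕ} {x : KPf} (hi : i + 1 ≤ n)
    (hh : headMinus (Wword n j x) = some (h, j + 1)) (hk : h = i ∨ h = i + 1) :
    headMinus (Wword n j x) = pairHead (i + 1) i (fun h => (h, j)) (fun h => (h, j + 1)) x := by
  obtain ⟨U, V, hL, hU, hV⟩ := reverse_range_split hi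
  rw [Wword_eq_genWord, hL] at hh ⊢
  rcases (genWord_pair_change (x := x) (y := x) (pl := fun h => (h, j))
    (mi := fun h => (h, j + 1)) (by simp) hU hV rfl rfl).2.2 with h1 | h1
  · obtain ⟨k', h2, h3, h4⟩ := h1.2 _ hh
    simp only [Prod.mk.injEq] at h4
    omega
  · exact h1.1

/-- The effect of `ẽ_i*` on the reduced word of `W_j`. -/
theorem Wword_star_move {n i j k : ℕ} {x : KPf} (hi : i + 1 ≤ n) (hj : j + 1 ≤ n)
    (h : headMinus (Wstar n i x) = some (i, k)) :
    aSt n j (KPmove x (i, k) (i + 1, k)) = aSt n j x ∧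
    bSt n j (KPmove x (i, k) (i + 1, k)) = bSt n j x ∧
    (headMinus (Wword n j (KPmove x (i, k) (i + 1, k))) = headMinus (Wword n j x) ∧
      (∀ r, headMinus (Wword n j x) = some r → r.1 ≠ i ∧ r.1 ≠ i + 1) ∨
      headMinus (Wword n j x) = pairHead (i + 1) i (fun h => (h, j)) (fun h => (h, j + 1)) x ∧
      headMinus (Wword n j (KPmove x (i, k) (i + 1, k))) =
        pairHead (i + 1) i (fun h => (h, j)) (fun h => (h, j + 1))
          (KPmove x (i, k) (i + 1, k))) := by
  obtain ⟨U, V, hL, hU, hV⟩ := reverse_range_split hi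
  have hb := star_block hj h
  rw [h, pairHead] at hb
  have hxk := (headMinus_Wstar h).2
  have key := genWord_pair_change (x := x) (y := KPmove x (i, k) (i + 1, k)) (pl := fun h => (h, j))
    (mi := fun h => (h, j + 1)) (s := i + 1) (t := i) (U := U) (V := V)
    (fun a h1 h2 => by simp [KPmove_apply, h1, h2]) hU hV
    (by simp only [KPmove_apply _ (show ((i, k) : Root) ≠ (i + 1, k) by simp)]; grind)
    (by simp only [KPmove_apply _ (show ((i, k) : Root) ≠ (i + 1, k) by simp)]; grind)
  rw [← hL] at key
  refine ⟨key.1, key.2.1, key.2.2.imp (fun h => ⟨h.1, fun r hr => ?_⟩) id⟩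
  obtain ⟨k', h2, h3, h4⟩ := h.2 _ hr
  rw [h4]
  exact ⟨h3, h2⟩

/-- The effect of `ẽ_j` on the reduced word of `W_i*`. -/
theorem Wstar_word_move {n i j h : ℕ} {x : KPf} (hi : i + 1 ≤ n) (hj : j + 1 ≤ n)
    (hh : headMinus (Wword n j x) = some (h, j + 1)) :
    aStar n i (KPmove x (h, j + 1) (h, j)) = aStar n i x ∧
    bStar n i (KPmove x (h, j + 1) (h, j)) = bStar n i x ∧
    (headMinus (Wstar n i (KPmove x (h, j + 1) (h, j))) = headMinus (Wstar n i x) ∧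
      (∀ r, headMinus (Wstar n i x) = some r → r.2 ≠ j ∧ r.2 ≠ j + 1) ∨
      headMinus (Wstar n i x) = pairHead j (j + 1) (fun k => (i + 1, k)) (fun k => (i, k)) x ∧
      headMinus (Wstar n i (KPmove x (h, j + 1) (h, j))) =
        pairHead j (j + 1) (fun k => (i + 1, k)) (fun k => (i, k))
          (KPmove x (h, j + 1) (h, j))) := by
  obtain ⟨U, V, hL, hU, hV⟩ := range_split hj
  have hb := word_block hi hh
  rw [hh, pairHead] at hb
  have hxk := (headMinus_Wword hh).2.1
  have key := genWord_pair_change (x := x) (y := KPmove x (h, j + 1) (h, j))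
    (pl := fun k => (i + 1, k)) (mi := fun k => (i, k)) (s := j) (t := j + 1) (U := U) (V := V)
    (fun a h1 h2 => by simp [KPmove_apply, h1, h2]) hU hV
    (by simp only [KPmove_apply _ (show ((h, j + 1) : Root) ≠ (h, j) by simp)]; grind)
    (by simp only [KPmove_apply _ (show ((h, j + 1) : Root) ≠ (h, j) by simp)]; grind)
  rw [← hL] at key
  refine ⟨key.1, key.2.1, key.2.2.imp (fun h => ⟨h.1, fun r hr => ?_⟩) id⟩
  obtain ⟨k', h2, h3, h4⟩ := h.2 _ hr
  rw [h4]
  exact ⟨h2, h3⟩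

/-- `ẽ_i*` and `ẽ_j` commute when both act. -/
theorem star_word_comm {n i j k h : ℕ} {x : KPf} (hi : i + 1 ≤ n) (hij : i + 1 < j)
    (hj : j + 1 ≤ n) (hk : headMinus (Wstar n i x) = some (i, k))
    (hh : headMinus (Wword n j x) = some (h, j + 1)) :
    ∃ k' h', (k' = k ∨ i + 1 < k') ∧ (h' = h ∨ h' < j) ∧
      headMinus (Wstar n i (KPmove x (h, j + 1) (h, j))) = some (i, k') ∧
      headMinus (Wword n j (KPmove x (i, k) (i + 1, k))) = some (h', j + 1) ∧
      KPmove (KPmove x (h, j + 1) (h, j)) (i, k') (i + 1, k') =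
        KPmove (KPmove x (i, k) (i + 1, k)) (h', j + 1) (h', j) := by
  obtain ⟨-, -, hT⟩ := Wword_star_move (j := j) hi hj hk
  obtain ⟨-, -, hS⟩ := Wstar_word_move (i := i) hi hj hh
  by_cases hkj : k = j ∨ k = j + 1
  · by_cases hhi : h = i ∨ h = i + 1
    · have hT' := hT.resolve_left fun q => by have := q.2 _ hh; simp at this; omega
      have hS' := hS.resolve_left fun q => by have := q.2 _ hk; simp at this; omega
      rw [hT'.2, hS'.2]
      have a1 := hT'.1
      have a2 := hS'.1
      rw [hh, pairHead] at a1
      rw [hk, pairHead] at a2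
      have e1 := KPmove_apply x (show ((i, k) : Root) ≠ (i + 1, k) by simp)
      have e2 := KPmove_apply x (show ((h, j + 1) : Root) ≠ (h, j) by simp)
      rcases lt_trichotomy (x (i, j)) (x (i + 1, j + 1)) with hlt | heq | hgt
      · rw [if_pos hlt] at a1
        rw [if_neg (by omega)] at a2
        obtain ⟨rfl⟩ : h = i + 1 := by simpa using a1
        split_ifs at a2 with hd
        obtain ⟨rfl⟩ : k = j + 1 := by simpa using a2
        refine ⟨j + 1, i + 1, Or.inl rfl, Or.inl rfl, ?_, ?_, ?_⟩
        · rw [pairHead, if_neg (by simp only [e2]; grind), if_pos (by simp only [e2]; grind)]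
        · rw [pairHead, if_pos (by simp only [e1]; grind)]
        · funext p
          simp only [KPmove, KPadd, KPsub]
          grind
      · rw [if_neg (by omega)] at a1 a2
        split_ifs at a1 a2 with hd
        obtain ⟨rfl⟩ : k = j + 1 := by simpa using a2
        obtain ⟨rfl⟩ : h = i := by simpa using a1
        refine ⟨j, i + 1, Or.inr hij, Or.inr hij, ?_, ?_, ?_⟩
        · rw [pairHead, if_pos (by simp only [e2]; grind)]
        · rw [pairHead, if_pos (by simp only [e1]; grind)]
        · funext p
          simp only [KPmove, KPadd, KPsub]
          grind
      · rw [if_neg (by omega)] at a1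
        rw [if_pos hgt] at a2
        split_ifs at a1 with hd
        obtain ⟨rfl⟩ : k = j := by simpa using a2
        obtain ⟨rfl⟩ : h = i := by simpa using a1
        refine ⟨j, i, Or.inl rfl, Or.inl rfl, ?_, ?_, ?_⟩
        · rw [pairHead, if_pos (by simp only [e2]; grind)]
        · rw [pairHead, if_neg (by simp only [e1]; grind), if_pos (by simp only [e1]; grind)]
        · funext p
          simp only [KPmove, KPadd, KPsub]
          grind
    · have hT' : headMinus (Wword n j (KPmove x (i, k) (i + 1, k))) = some (h, j + 1) := by
        rcases hT with q | q
        · rw [q.1, hh]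
        · exfalso
          have a1 := q.1
          rw [hh, pairHead] at a1
          split_ifs at a1 <;> grind
      have hw : Wstar n i (KPmove x (h, j + 1) (h, j)) = Wstar n i x :=
        Wstar_move x (by grind) (by grind) (by grind) (by grind)
      exact ⟨k, h, Or.inl rfl, Or.inl rfl, by rw [hw, hk], hT',
        KPmove_comm x (by grind) (by grind) (by grind) (by grind)⟩
  · have hS' : headMinus (Wstar n i (KPmove x (h, j + 1) (h, j))) = some (i, k) := by
      rcases hS with q | q
      · rw [q.1, hk]
      · exfalso
        have a1 := q.1
        rw [hk, pairHead] at a1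
        split_ifs at a1 <;> grind
    have hw : Wword n j (KPmove x (i, k) (i + 1, k)) = Wword n j x :=
      Wword_move x (by grind) (by grind) (by grind) (by grind)
    exact ⟨k, h, Or.inl rfl, Or.inl rfl, hS', by rw [hw, hh],
      KPmove_comm x (by grind) (by grind) (by grind) (by grind)⟩

/-- Stembridge's axiom S2 for `i + 1 < j`. -/
theorem stembridge_S2_of_lt {n i j : ℕ} (hi1 : 1 ≤ i) (hij : i + 1 < j) (hj : j + 1 ≤ n)
    {x : KPf} (hx : IsKP n x) (hei : eop n i x ≠ none) (hej : eop n j x ≠ none) :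
    (eop n j x).bind (eop n i) = (eop n i x).bind (eop n j) ∧
    (eop n j x).bind (eop n i) ≠ none ∧
    phiO n i (eop n j x) = phiS n i x ∧ phiO n j (eop n i x) = phiS n j x := by
  have hin : i + 1 ≤ n := by omega
  have hj1 : 1 ≤ j := by omega
  suffices ∃ y z w, eop n i x = some y ∧ eop n j x = some z ∧ eop n i z = some w ∧
      eop n j y = some w ∧ phiS n i z = phiS n i x ∧ phiS n j y = phiS n j x by
    obtain ⟨y, z, w, h1, h2, h3, h4, h5, h6⟩ := this
    simp [h1, h2, h3, h4, h5, h6, phiO]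
  rcases eop_cases hx hei with ⟨ci, h, h1, hlt, -, hi⟩ | ⟨ci, k, hlt, hkn, -, hi⟩ <;>
  rcases eop_cases hx hej with ⟨cj, h', h1', hlt', -, hj'⟩ | ⟨cj, k', hlt', hkn', -, hj'⟩
  · have eWj : Wword n j (KPmove x (h, i + 1) (h, i)) = Wword n j x :=
      Wword_move x (by grind) (by grind) (by grind) (by grind)
    have eSj : Wstar n j (KPmove x (h, i + 1) (h, i)) = Wstar n j x :=
      Wstar_move x (by grind) (by grind) (by grind) (by grind)
    have eWi : Wword n i (KPmove x (h', j + 1) (h', j)) = Wword n i x :=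
      Wword_move x (by grind) (by grind) (by grind) (by grind)
    obtain ⟨cA, cB, -⟩ := Wstar_word_move (i := i) hin hj hj'
    have cW : aSt n i (KPmove x (h', j + 1) (h', j)) = aSt n i x := by rw [aSt, eWi, aSt]
    refine ⟨_, _, _, eop_of_Wword ci hi hlt.ne, eop_of_Wword cj hj' hlt'.ne,
      eop_of_Wword (by omega) (by rw [eWi, hi]) hlt.ne, ?_, ?_, ?_⟩
    · rw [eop_of_Wword (by simpa only [aSt, bStar, eWj, eSj] using cj) (by rw [eWj, hj']) hlt'.ne]
      rw [KPmove_comm x (by grind) (by grind) (by grind) (by grind)]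
    · exact phiS_congr hi1 hin hx (hx.move _ ⟨h1', hlt', by omega⟩) cW cB cA
    · exact phiS_congr hj1 hj hx (hx.move _ ⟨h1, hlt, by omega⟩) (by simp only [aSt, eWj])
        (by simp only [bStar, eSj]) (by simp only [aStar, eSj])
  · have eWj : Wword n j (KPmove x (h, i + 1) (h, i)) = Wword n j x :=
      Wword_move x (by grind) (by grind) (by grind) (by grind)
    have eSj : Wstar n j (KPmove x (h, i + 1) (h, i)) = Wstar n j x :=
      Wstar_move x (by grind) (by grind) (by grind) (by grind)
    have eWi : Wword n i (KPmove x (j, k') (j + 1, k')) = Wword n i x :=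
      Wword_move x (by grind) (by grind) (by grind) (by grind)
    have eSi : Wstar n i (KPmove x (j, k') (j + 1, k')) = Wstar n i x :=
      Wstar_move x (by grind) (by grind) (by grind) (by grind)
    refine ⟨_, _, _, eop_of_Wword ci hi hlt.ne, eop_of_Wstar cj hj' hlt'.ne',
      eop_of_Wword (by simpa only [aSt, bStar, eWi, eSi] using ci) (by rw [eWi, hi]) hlt.ne,
      ?_, ?_, ?_⟩
    · rw [eop_of_Wstar (by simpa only [aSt, bStar, eWj, eSj] using cj) (by rw [eSj, hj']) hlt'.ne']
      rw [KPmove_comm x (by grind) (by grind) (by grind) (by grind)]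
    · exact phiS_congr hi1 hin hx (hx.move _ ⟨by simp, hlt', hkn'⟩) (by simp only [aSt, eWi])
        (by simp only [bStar, eSi]) (by simp only [aStar, eSi])
    · exact phiS_congr hj1 hj hx (hx.move _ ⟨h1, hlt, by omega⟩) (by simp only [aSt, eWj])
        (by simp only [bStar, eSj]) (by simp only [aStar, eSj])
  · have eSj : Wstar n j (KPmove x (i, k) (i + 1, k)) = Wstar n j x :=
      Wstar_move x (by grind) (by grind) (by grind) (by grind)
    have eWi : Wword n i (KPmove x (h', j + 1) (h', j)) = Wword n i x :=
      Wword_move x (by grind) (by grind) (by grind) (by grind)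
    obtain ⟨cA, cB, -⟩ := Wstar_word_move (i := i) hin hj hj'
    obtain ⟨dA, -, -⟩ := Wword_star_move (j := j) hin hj hi
    have cW : aSt n i (KPmove x (h', j + 1) (h', j)) = aSt n i x := by rw [aSt, eWi, aSt]
    have dS : bStar n j (KPmove x (i, k) (i + 1, k)) = bStar n j x := by rw [bStar, eSj, bStar]
    obtain ⟨k₂, h₂, hk₂, hh₂, m1, m2, m3⟩ := star_word_comm hin hij hj hi hj'
    refine ⟨_, _, _, eop_of_Wstar ci hi hlt.ne', eop_of_Wword cj hj' hlt'.ne,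
      eop_of_Wstar (by omega) m1 (by omega), ?_, ?_, ?_⟩
    · rw [eop_of_Wword (by omega) m2 (by omega), m3]
    · exact phiS_congr hi1 hin hx (hx.move _ ⟨h1', hlt', by omega⟩) cW cB cA
    · exact phiS_congr hj1 hj hx (hx.move _ ⟨by simp, hlt, hkn⟩) dA dS
        (by simp only [aStar, eSj])
  · have eSj : Wstar n j (KPmove x (i, k) (i + 1, k)) = Wstar n j x :=
      Wstar_move x (by grind) (by grind) (by grind) (by grind)
    have eWi : Wword n i (KPmove x (j, k') (j + 1, k')) = Wword n i x :=
      Wword_move x (by grind) (by grind) (by grind) (by grind)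
    have eSi : Wstar n i (KPmove x (j, k') (j + 1, k')) = Wstar n i x :=
      Wstar_move x (by grind) (by grind) (by grind) (by grind)
    obtain ⟨dA, -, -⟩ := Wword_star_move (j := j) hin hj hi
    have dS : bStar n j (KPmove x (i, k) (i + 1, k)) = bStar n j x := by rw [bStar, eSj, bStar]
    refine ⟨_, _, _, eop_of_Wstar ci hi hlt.ne', eop_of_Wstar cj hj' hlt'.ne',
      eop_of_Wstar (by simpa only [aSt, bStar, eWi, eSi] using ci) (by rw [eSi, hi]) hlt.ne',
      ?_, ?_, ?_⟩
    · rw [eop_of_Wstar (by omega) (by rw [eSj, hj']) hlt'.ne']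
      rw [KPmove_comm x (by grind) (by grind) (by grind) (by grind)]
    · exact phiS_congr hi1 hin hx (hx.move _ ⟨by simp, hlt', hkn'⟩) (by simp only [aSt, eWi])
        (by simp only [bStar, eSi]) (by simp only [aStar, eSi])
    · exact phiS_congr hj1 hj hx (hx.move _ ⟨by simp, hlt, hkn⟩) dA dS
        (by simp only [aStar, eSj])

end KFC


open KFC in
/-- Stembridge axiom S2 (orthogonal case) for the modified operators:
if `|i−j| > 1` and `e_i(x) ≠ 0 ≠ e_j(x)`, then `e_i(e_j(x)) = e_j(e_i(x)) ≠ 0`,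
`φ_i(e_j(x)) = φ_i(x)` and `φ_j(e_i(x)) = φ_j(x)`. -/
theorem stmt11 (n : ℕ) (hn : 2 ≤ n) (i j : ℕ)
    (hi1 : 1 ≤ i) (hi2 : i ≤ n - 1) (hj1 : 1 ≤ j) (hj2 : j ≤ n - 1) (hij : i + 1 < j ∨ j + 1 < i)
    (x : KPf) (hx : IsKP n x) (hei : eop n i x ≠ none) (hej : eop n j x ≠ none) :
    (eop n j x).bind (eop n i) = (eop n i x).bind (eop n j) ∧
    (eop n j x).bind (eop n i) ≠ none ∧
    phiO n i (eop n j x) = phiS n i x ∧ phiO n j (eop n i x) = phiS n j x := by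
  rcases hij with h | h
  · exact stembridge_S2_of_lt hi1 h (by omega) hx hei hej
  · obtain ⟨h1, h2, h3, h4⟩ := stembridge_S2_of_lt hj1 h (by omega) hx hej hei
    exact ⟨h1.symm, h1 ▸ h2, h4, h3⟩
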